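/- (Lemma 2, symmetry and trace parts.) Let P_{ab} be a smooth symmetric 2-tensor on U satisfying D^bP_{ab} - D_aP = 0 and (□ - 3)P_{ab} + P h⁰_{ab} - D_aD_bP = 0 on U, where P = Σ_{a,b} h⁰^{ab}P_{ab}. Then the tensor T_{ab} = Σ_{c,d} ε_a{}^{cd} D_cP_{db} is symmetric, T_{ab} = T_{ba}, and traceless, Σ_{a,b} h⁰^{ab}T_{ab} = 0, at every point of U. -/

import Mathlib

noncomputable section

/-- Points of the chart `U = ℝ × (0,π) × ℝ` with coordinates `(τ, θ, φ)`. -/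
abbrev Pt : Type := Fin 3 → ℝ

/-- The coordinate domain `U = ℝ × (0,π) × ℝ`. -/
def U : Set Pt := {x | 0 < x 1 ∧ x 1 < Real.pi}

/-- Partial derivative `∂_i f` at `x`. -/
noncomputable def pd (i : Fin 3) (f : Pt → ℝ) (x : Pt) : ℝ :=
  deriv (fun t => f (Function.update x i t)) (x i)

/-- The unit-hyperboloid (dS₃) metric `h⁰_{ab}`. -/
noncomputable def h0 (x : Pt) : Fin 3 → Fin 3 → ℝ :=
  ![![-1, 0, 0],
    ![0, Real.cosh (x 0) ^ 2, 0],
    ![0, 0, Real.cosh (x 0) ^ 2 * Real.sin (x 1) ^ 2]]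

/-- The inverse metric `h⁰^{ab}`. -/
noncomputable def h0inv (x : Pt) : Fin 3 → Fin 3 → ℝ :=
  ![![-1, 0, 0],
    ![0, 1 / Real.cosh (x 0) ^ 2, 0],
    ![0, 0, 1 / (Real.cosh (x 0) ^ 2 * Real.sin (x 1) ^ 2)]]

/-- Christoffel symbols `Γ^c_{ab}` of `h⁰`; first index is the upper index. -/
noncomputable def Chr (x : Pt) : Fin 3 → Fin 3 → Fin 3 → ℝ :=
  ![![![0, 0, 0],
      ![0, Real.sinh (x 0) * Real.cosh (x 0), 0],
      ![0, 0, Real.sinh (x 0) * Real.cosh (x 0) * Real.sin (x 1) ^ 2]],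
    ![![0, Real.tanh (x 0), 0],
      ![Real.tanh (x 0), 0, 0],
      ![0, 0, -(Real.sin (x 1) * Real.cos (x 1))]],
    ![![0, 0, Real.tanh (x 0)],
      ![0, 0, Real.cos (x 1) / Real.sin (x 1)],
      ![Real.tanh (x 0), Real.cos (x 1) / Real.sin (x 1), 0]]]

/-- Covariant Hessian `D_a D_b f = ∂_a ∂_b f - Σ_c Γ^c_{ab} ∂_c f`. -/
noncomputable def hess (f : Pt → ℝ) (x : Pt) (a b : Fin 3) : ℝ :=
  pd a (pd b f) x - ∑ c, Chr x c a b * pd c f x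

/-- Covariant derivative `D_c T_{ab}` of a 2-tensor. -/
noncomputable def covD (T : Pt → Fin 3 → Fin 3 → ℝ) (x : Pt) (c a b : Fin 3) : ℝ :=
  pd c (fun y => T y a b) x - (∑ d, Chr x d c a * T x d b) - (∑ d, Chr x d c b * T x a d)

/-- Second covariant derivative `D_d D_c T_{ab}`, treating `D_c T_{ab}` as a 3-tensor. -/
noncomputable def covD2 (T : Pt → Fin 3 → Fin 3 → ℝ) (x : Pt) (d c a b : Fin 3) : ℝ :=
  pd d (fun y => covD T y c a b) x
    - (∑ e, Chr x e d c * covD T x e a b)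
    - (∑ e, Chr x e d a * covD T x c e b)
    - (∑ e, Chr x e d b * covD T x c a e)

/-- Tensor Laplacian `□T_{ab} = Σ_{c,d} h⁰^{cd} D_d D_c T_{ab}`. -/
noncomputable def boxT (T : Pt → Fin 3 → Fin 3 → ℝ) (x : Pt) (a b : Fin 3) : ℝ :=
  ∑ c, ∑ d, h0inv x c d * covD2 T x d c a b

/-- Totally antisymmetric Levi-Civita symbol with `levi 0 1 2 = 1`. -/
def levi : Fin 3 → Fin 3 → Fin 3 → ℝ :=
  ![![![0, 0, 0], ![0, 0, 1], ![0, -1, 0]],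
    ![![0, 0, -1], ![0, 0, 0], ![1, 0, 0]],
    ![![0, 1, 0], ![-1, 0, 0], ![0, 0, 0]]]

/-- Volume tensor `ε_{abc}` with `ε_{τθφ} = cosh²τ sinθ`. -/
noncomputable def epsLow (x : Pt) (a b c : Fin 3) : ℝ :=
  levi a b c * (Real.cosh (x 0) ^ 2 * Real.sin (x 1))

/-- `ε_a{}^{cd} = Σ_{e,f} ε_{aef} h⁰^{ec} h⁰^{fd}`. -/
noncomputable def epsMixed (x : Pt) (a c d : Fin 3) : ℝ :=
  ∑ e, ∑ f, epsLow x a e f * h0inv x e c * h0inv x f d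

/-- Curl of a 2-tensor: `(curl T)_{ab} = Σ_{c,d} ε_a{}^{cd} D_c T_{db}`. -/
noncomputable def curlT (T : Pt → Fin 3 → Fin 3 → ℝ) (x : Pt) (a b : Fin 3) : ℝ :=
  ∑ c, ∑ d, epsMixed x a c d * covD T x c d b

theorem isOpen_U : IsOpen U :=
  (isOpen_lt continuous_const (continuous_apply 1)).inter
    (isOpen_lt (continuous_apply 1) continuous_const)

/-- On a differentiable function, `pd` is a genuine derivative along the coordinate line. -/
theorem hasDerivAt_pd {f : Pt → ℝ} {x : Pt} (hf : DifferentiableAt ℝ f x) (i : Fin 3) :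
    HasDerivAt (fun t => f (Function.update x i t)) (pd i f x) (x i) := by
  refine DifferentiableAt.hasDerivAt ?_
  have hu : DifferentiableAt ℝ (fun t => Function.update x i t) (x i) :=
    (hasDerivAt_update x i (x i)).differentiableAt
  refine DifferentiableAt.comp (g := f) (x i) ?_ hu
  rwa [Function.update_eq_self]

/-- `pd` depends only on the germ of the function. -/
theorem pd_congr {f g : Pt → ℝ} {x : Pt} (h : f =ᶠ[nhds x] g) (i : Fin 3) :
    pd i f x = pd i g x := by
  refine Filter.EventuallyEq.deriv_eq ?_
  have hc : Filter.Tendsto (fun t => Function.update x i t) (nhds (x i)) (nhds x) := by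
    have := (hasDerivAt_update x i (x i)).continuousAt.tendsto
    rwa [Function.update_eq_self] at this
  exact hc.eventually h

/-- The covariant derivative of a symmetric tensor is symmetric in the tensor indices. -/
theorem covD_symm {P : Pt → Fin 3 → Fin 3 → ℝ}
    (hsym : ∀ x ∈ U, ∀ a b : Fin 3, P x a b = P x b a) {x : Pt} (hx : x ∈ U) (c a b : Fin 3) :
    covD P x c a b = covD P x c b a := by
  have h : pd c (fun y => P y a b) x = pd c (fun y => P y b a) x :=
    pd_congr (by filter_upwards [isOpen_U.mem_nhds hx] with y hy using hsym y hy a b) c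
  simp only [covD, h, hsym x hx _ a, hsym x hx b]
  ring

/-- The metric trace of a 2-tensor in components. -/
theorem sum_h0inv (x : Pt) (T : Fin 3 → Fin 3 → ℝ) :
    ∑ a, ∑ b, h0inv x a b * T a b = -T 0 0 + T 1 1 / Real.cosh (x 0) ^ 2
      + T 2 2 / (Real.cosh (x 0) ^ 2 * Real.sin (x 1) ^ 2) := by
  simp [Fin.sum_univ_three, h0inv]
  ring

/-- Metric compatibility: the derivative of the trace is the trace of the covariant derivative. -/
theorem pd_trace {P : Pt → Fin 3 → Fin 3 → ℝ} {x : Pt} (hx : x ∈ U)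
    (hP : ∀ a b : Fin 3, DifferentiableAt ℝ (fun y => P y a b) x) (c : Fin 3) :
    pd c (fun y => ∑ a, ∑ b, h0inv y a b * P y a b) x
      = ∑ a, ∑ b, h0inv x a b * covD P x c a b := by
  have hs : Real.sin (x 1) ≠ 0 := (Real.sin_pos_of_pos_of_lt_pi hx.1 hx.2).ne'
  have hc : Real.cosh (x 0) ≠ 0 := (Real.cosh_pos _).ne'
  have hP0 := hasDerivAt_pd (hP 0 0) c
  have hP1 := hasDerivAt_pd (hP 1 1) c
  have hP2 := hasDerivAt_pd (hP 2 2) c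
  simp only [sum_h0inv]
  rw [pd]
  fin_cases c
  · have hC := (Real.hasDerivAt_cosh (x 0)).pow 2
    have key := (hP0.neg.add (hP1.div hC (by simpa using hc))).add
      (hP2.div (hC.mul_const (Real.sin (x 1) ^ 2)) (by simp [hc, hs]))
    refine Eq.trans (HasDerivAt.deriv (key.congr_of_eventuallyEq
      (Filter.Eventually.of_forall fun t => by simp))) ?_
    simp [covD, Chr, Fin.sum_univ_three, Real.tanh_eq_sinh_div_cosh]
    field_simp
    ring
  · have hS := (Real.hasDerivAt_sin (x 1)).pow 2
    have key := (hP0.neg.add (hP1.div_const (Real.cosh (x 0) ^ 2))).add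
      (hP2.div (hS.const_mul (Real.cosh (x 0) ^ 2)) (by simp [hc, hs]))
    refine Eq.trans (HasDerivAt.deriv (key.congr_of_eventuallyEq
      (Filter.Eventually.of_forall fun t => by simp))) ?_
    simp [covD, Chr, Fin.sum_univ_three, Real.tanh_eq_sinh_div_cosh]
    field_simp
    ring
  · have key := (hP0.neg.add (hP1.div_const (Real.cosh (x 0) ^ 2))).add
      (hP2.div_const (Real.cosh (x 0) ^ 2 * Real.sin (x 1) ^ 2))
    refine Eq.trans (HasDerivAt.deriv (key.congr_of_eventuallyEq
      (Filter.Eventually.of_forall fun t => by simp))) ?_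
    simp [covD, Chr, Fin.sum_univ_three, Real.tanh_eq_sinh_div_cosh]
    field_simp
    ring

/-- Lemma 2 (symmetry and trace parts): for `P_{ab}` symmetric with
`D^bP_{ab} - D_aP = 0` and `(□-3)P_{ab} + P h⁰_{ab} - D_aD_bP = 0`, the tensor
`T_{ab} = Σ_{c,d} ε_a{}^{cd} D_cP_{db}` is symmetric and traceless on `U`. -/
theorem stmt7 (P : Pt → Fin 3 → Fin 3 → ℝ)
    (hP : ∀ a b : Fin 3, ContDiffOn ℝ (⊤ : ℕ∞) (fun x => P x a b) U)
    (hsym : ∀ x ∈ U, ∀ a b : Fin 3, P x a b = P x b a)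
    (hdiv : ∀ x ∈ U, ∀ a : Fin 3,
      (∑ b, ∑ c, h0inv x b c * covD P x c a b)
        - pd a (fun y => ∑ a', ∑ b', h0inv y a' b' * P y a' b') x = 0)
    (heq : ∀ x ∈ U, ∀ a b : Fin 3,
      boxT P x a b - 3 * P x a b
        + (∑ a', ∑ b', h0inv x a' b' * P x a' b') * h0 x a b
        - hess (fun y => ∑ a', ∑ b', h0inv y a' b' * P y a' b') x a b = 0) :
    ∀ x ∈ U,
      (∀ a b : Fin 3, curlT P x a b = curlT P x b a) ∧
      (∑ a, ∑ b, h0inv x a b * curlT P x a b) = 0 := by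
  intro x hx
  have hs : Real.sin (x 1) ≠ 0 := (Real.sin_pos_of_pos_of_lt_pi hx.1 hx.2).ne'
  have hc : Real.cosh (x 0) ≠ 0 := (Real.cosh_pos _).ne'
  have hd : ∀ a b : Fin 3, DifferentiableAt ℝ (fun y => P y a b) x := fun a b =>
    ((hP a b).contDiffAt (isOpen_U.mem_nhds hx)).differentiableAt (by simp)
  have hC := covD_symm hsym hx
  have hD : ∀ a, (∑ b, ∑ c, h0inv x b c * covD P x c a b)
      - ∑ b, ∑ c, h0inv x b c * covD P x a b c = 0 := fun a => by
    rw [← pd_trace hx hd a]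
    exact hdiv x hx a
  have h10 := fun c => hC c 1 0
  have h20 := fun c => hC c 2 0
  have h21 := fun c => hC c 2 1
  have d0 := hD 0
  have d1 := hD 1
  have d2 := hD 2
  simp only [sum_h0inv, h10, h20, h21] at d0 d1 d2
  field_simp at d0 d1 d2
  have e01 : curlT P x 0 1 = curlT P x 1 0 := by
    simp [curlT, epsMixed, epsLow, levi, h0inv, Fin.sum_univ_three, h10, h20, h21]
    field_simp
    refine mul_left_cancel₀ (pow_ne_zero 2 hs) ?_
    linear_combination d2
  have e02 : curlT P x 0 2 = curlT P x 2 0 := by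
    simp [curlT, epsMixed, epsLow, levi, h0inv, Fin.sum_univ_three, h10, h20]
    field_simp
    linear_combination -d1
  have e12 : curlT P x 1 2 = curlT P x 2 1 := by
    simp [curlT, epsMixed, epsLow, levi, h0inv, Fin.sum_univ_three, h21]
    field_simp
    linear_combination -d0
  refine ⟨fun a b => ?_, ?_⟩
  · fin_cases a <;> fin_cases b <;> simp [e01, e02, e12]
  · rw [sum_h0inv]
    simp [curlT, epsMixed, epsLow, levi, h0inv, Fin.sum_univ_three, h10, h20, h21]
    field_simp
    ring
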